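/- If T is a tree with odd maximum degree Δ(T) ≥ 5, then for every Abelian group 𝒢 of odd order |𝒢| ≥ Δ(T) + 2 there exists a nowhere-zero 𝒢-twin edge coloring of T, except in the case when T is a (|𝒢| − 2)-regular tree. -/

import Mathlib

open Finset SimpleGraph

/-- A `𝒢`-twin edge coloring of `G`: a proper edge labeling `f : E(G) → 𝒢` such that
the induced weighted degrees `w(v) = ∑_{u ∈ N(v)} f(uv)` differ on adjacent vertices. -/
def IsTwinEdgeColoring {V : Type} [Fintype V] (G : SimpleGraph V) [DecidableRel G.Adj]
    {A : Type} [AddCommGroup A] (f : Sym2 V → A) : Prop :=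
  (∀ u v w : V, G.Adj u v → G.Adj u w → v ≠ w → f s(u, v) ≠ f s(u, w)) ∧
  (∀ u v : V, G.Adj u v →
    ∑ x ∈ G.neighborFinset u, f s(x, u) ≠ ∑ x ∈ G.neighborFinset v, f s(x, v))


/-- A tree is `r`-regular if every non-leaf vertex has degree `r`. -/
def IsRegularTreeDeg {V : Type} [Fintype V] (G : SimpleGraph V) [DecidableRel G.Adj]
    (r : ℕ) : Prop :=
  ∀ v : V, G.degree v ≠ 1 → G.degree v = r

/-- A symmetric set of nonzero elements contains zero-sum subsets of each even size. -/
lemma aux_pairs {A : Type} [AddCommGroup A] [DecidableEq A] (hne : ∀ a : A, a ≠ 0 → a ≠ -a) (j : ℕ) :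
    ∀ P : Finset A, (∀ a ∈ P, a ≠ 0) → (∀ a ∈ P, -a ∈ P) → 2 * j ≤ P.card →
    ∃ C ⊆ P, C.card = 2 * j ∧ ∑ c ∈ C, c = 0 := by
  induction j with
  | zero => intro P _ _ _; exact ⟨∅, by simp, by simp, by simp⟩
  | succ j ih =>
    intro P h0 hs hc
    obtain ⟨a, ha⟩ : P.Nonempty := by
      rw [← Finset.card_pos]; omega
    have hna := hs a ha
    have haa := hne a (h0 a ha)
    have h1 : ((P.erase a).erase (-a)).card = P.card - 2 := by
      rw [Finset.card_erase_of_mem (Finset.mem_erase.2 ⟨haa.symm, hna⟩), Finset.card_erase_of_mem ha]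
      omega
    obtain ⟨C, hC, hcard, hsum⟩ := ih ((P.erase a).erase (-a)) (by grind)
      (by
        intro b hb
        simp only [Finset.mem_erase] at hb ⊢
        refine ⟨fun h => hb.2.1 (neg_injective h), fun h => hb.1 ?_, hs b hb.2.2⟩
        rw [← h, neg_neg]) (by omega)
    have hn1 : -a ∉ C := fun h => by simpa using hC h
    have hn2 : a ∉ insert (-a) C := by
      intro h
      rcases Finset.mem_insert.1 h with h | h
      · exact haa h
      · simpa using hC h
    refine ⟨insert a (insert (-a) C), ?_, ?_, ?_⟩
    · intro b hb
      simp only [Finset.mem_insert] at hb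
      rcases hb with rfl | rfl | hb
      · exact ha
      · exact hna
      · have := hC hb; simp only [Finset.mem_erase] at this; exact this.2.2
    · rw [Finset.card_insert_of_notMem hn2, Finset.card_insert_of_notMem hn1]; omega
    · rw [Finset.sum_insert hn2, Finset.sum_insert hn1, hsum]; simp

lemma aux_odd {A : Type} [AddCommGroup A] [Fintype A] (hodd : Odd (Fintype.card A)) :
    ∀ a : A, a + a = 0 → a = 0 := by
  intro a h
  have h1 : addOrderOf a ∣ 2 := addOrderOf_dvd_of_nsmul_eq_zero (by rw [two_nsmul, h])
  have h2 : addOrderOf a ∣ Fintype.card A := addOrderOf_dvd_card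
  have h3 : addOrderOf a ∣ 1 := by
    have := Nat.dvd_gcd h1 h2
    rwa [(Nat.coprime_two_left.2 hodd)] at this
  simpa using h3

/-- Zero-sum subsets of the nonzero elements different from `x`. -/
lemma aux_zero {A : Type} [AddCommGroup A] [Fintype A] [DecidableEq A] (hodd : Odd (Fintype.card A))
    (hn : 7 ≤ Fintype.card A) (x : A) (hx : x ≠ 0) (k : ℕ) (hk1 : k ≠ 1)
    (hk : k + 3 ≤ Fintype.card A) :
    ∃ C : Finset A, C.card = k ∧ (∀ c ∈ C, c ≠ 0 ∧ c ≠ x) ∧ ∑ c ∈ C, c = 0 := by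
  have h2 := aux_odd hodd
  have hne : ∀ a : A, a ≠ 0 → a ≠ -a := by
    intro a ha h
    apply ha; apply h2
    nth_rewrite 1 [h]; simp
  rcases Nat.even_or_odd k with hev | hod
  · obtain ⟨j, hj⟩ := hev
    have hcard : Fintype.card A - 3 ≤ (({0, x, -x} : Finset A)ᶜ).card := by
      rw [Finset.card_compl]
      have := Finset.card_le_three (a := (0:A)) (b := x) (c := -x)
      omega
    obtain ⟨C, hC, hc, hs⟩ := aux_pairs hne j (({0, x, -x} : Finset A)ᶜ) (by simp; tauto)
      (by
        intro a ha
        simp only [Finset.mem_compl, Finset.mem_insert, Finset.mem_singleton, not_or] at ha ⊢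
        refine ⟨by simpa using ha.1, fun h => ha.2.2 (by rw [← h, neg_neg]),
          fun h => ha.2.1 (neg_injective h)⟩) (by omega)
    refine ⟨C, by omega, ?_, hs⟩
    intro c hc
    have := hC hc
    simp only [Finset.mem_compl, Finset.mem_insert, Finset.mem_singleton, not_or] at this
    exact ⟨this.1, this.2.1⟩
  · obtain ⟨j, hj⟩ := hod
    obtain ⟨i, hi⟩ := hodd
    -- choose b
    have hinj : Function.Injective (fun a : A => a + a) := by
      intro a b h
      have h' : a + a = b + b := h
      have : (a - b) + (a - b) = 0 := by
        have : (a - b) + (a - b) = (a + a) - (b + b) := by abel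
        rw [this, h', sub_self]
      exact sub_eq_zero.1 (h2 _ this)
    obtain ⟨y, hy⟩ := (Finite.injective_iff_surjective.1 hinj) x
    have hy' : y + y = x := hy
    obtain ⟨b, hb⟩ : ∃ b, b ∉ ({0, x, -x, x + x, y} : Finset A) := by
      by_contra! hcon
      have h5 := Finset.card_le_five (a := (0:A)) (b := x) (c := -x) (d := x + x) (e := y)
      have : ({0, x, -x, x + x, y} : Finset A) = Finset.univ := by
        rw [Finset.eq_univ_iff_forall]; exact hcon
      rw [this, Finset.card_univ] at h5
      omega
    simp only [Finset.mem_insert, Finset.mem_singleton, not_or] at hb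
    obtain ⟨b0, bx, bnx, bxx, bY⟩ := hb
    let P : Finset A := ({0, x, -x, b, -b, x - b, b - x} : Finset A)ᶜ
    have hP : Fintype.card A - 7 ≤ P.card := by
      rw [Finset.card_compl]
      have : ({0, x, -x, b, -b, x - b, b - x} : Finset A).card ≤ 7 := by
        refine (Finset.card_insert_le _ _).trans ?_
        have := Finset.card_le_six (a := x) (b := -x) (c := b) (d := -b) (e := x - b) (f := b - x)
        omega
      omega
    obtain ⟨C, hC, hc, hs⟩ := aux_pairs hne (j - 1) P (by simp [P]; tauto)
      (by
        intro a ha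
        simp only [P, Finset.mem_compl, Finset.mem_insert, Finset.mem_singleton, not_or] at ha ⊢
        obtain ⟨a0, a1, a2, a3, a4, a5, a6⟩ := ha
        refine ⟨by simpa using a0, fun h => a2 (by rw [← h, neg_neg]),
          fun h => a1 (neg_injective h), fun h => a4 (by rw [← h, neg_neg]),
          fun h => a3 (neg_injective h), fun h => a6 ?_, fun h => a5 ?_⟩
        · rw [← neg_neg a, h]; abel
        · rw [← neg_neg a, h]; abel) (by omega)
    have hCm : ∀ c ∈ C, c ≠ 0 ∧ c ≠ x ∧ c ≠ -x ∧ c ≠ b ∧ c ≠ x - b := by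
      intro c hc
      have := hC hc
      simp only [P, Finset.mem_compl, Finset.mem_insert, Finset.mem_singleton, not_or] at this
      tauto
    have e1 : x - b ∉ C := fun h => (hCm _ h).2.2.2.2 rfl
    have e2 : b ∉ insert (x - b) C := by
      intro h
      rcases Finset.mem_insert.1 h with h | h
      · apply bY; apply hinj
        change b + b = y + y
        rw [hy']; nth_rewrite 1 [h]; abel
      · exact (hCm _ h).2.2.2.1 rfl
    have e3 : -x ∉ insert b (insert (x - b) C) := by
      intro h
      rcases Finset.mem_insert.1 h with h | h
      · exact bnx h.symm
      rcases Finset.mem_insert.1 h with h | h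
      · apply bxx
        have : b = x - (x - b) := by abel
        rw [this, ← h]; abel
      · exact (hCm _ h).2.2.1 rfl
    refine ⟨insert (-x) (insert b (insert (x - b) C)), ?_, ?_, ?_⟩
    · rw [Finset.card_insert_of_notMem e3, Finset.card_insert_of_notMem e2,
        Finset.card_insert_of_notMem e1, hc]
      omega
    · intro c hc
      simp only [Finset.mem_insert] at hc
      rcases hc with rfl | rfl | rfl | hc
      · exact ⟨by simpa using hx, fun h => hne x hx h.symm⟩
      · exact ⟨b0, bx⟩
      · exact ⟨fun h => bx (sub_eq_zero.1 h).symm, fun h => b0 (by simpa using h)⟩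
      · exact ⟨(hCm c hc).1, (hCm c hc).2.1⟩
    · rw [Finset.sum_insert e3, Finset.sum_insert e2, Finset.sum_insert e1, hs]; abel

/-- The local choice at a non-root vertex. -/
lemma aux_nonroot {A : Type} [AddCommGroup A] [Fintype A] [DecidableEq A]
    (hodd : Odd (Fintype.card A))
    (hn : 7 ≤ Fintype.card A) (x s : A) (hx : x ≠ 0) (hxs : x ≠ s) (k : ℕ)
    (hk : k + 3 ≤ Fintype.card A) :
    ∃ C : Finset A, C.card = k ∧ (∀ c ∈ C, c ≠ 0 ∧ c ≠ x ∧ c ≠ x + ∑ c ∈ C, c) ∧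
      x + ∑ c ∈ C, c ≠ s := by
  by_cases hk1 : k = 1
  · obtain ⟨b, hb⟩ : ∃ b, b ∉ ({0, x, s - x} : Finset A) := by
      by_contra! hcon
      have h5 := Finset.card_le_three (a := (0:A)) (b := x) (c := s - x)
      have : ({0, x, s - x} : Finset A) = Finset.univ := by
        rw [Finset.eq_univ_iff_forall]; exact hcon
      rw [this, Finset.card_univ] at h5
      omega
    simp only [Finset.mem_insert, Finset.mem_singleton, not_or] at hb
    refine ⟨{b}, by simp [hk1], ?_, ?_⟩
    · simp only [Finset.mem_singleton, Finset.sum_singleton]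
      rintro c rfl
      exact ⟨hb.1, hb.2.1, by simpa using hx⟩
    · rw [Finset.sum_singleton]
      intro h
      exact hb.2.2 (by rw [← h]; abel)
  · obtain ⟨C, h1, h2, h3⟩ := aux_zero hodd hn x hx k hk1 hk
    refine ⟨C, h1, ?_, by simpa [h3] using hxs⟩
    intro c hc
    rw [h3, add_zero]
    exact ⟨(h2 c hc).1, (h2 c hc).2, (h2 c hc).2⟩

lemma aux_root {A : Type} [AddCommGroup A] [Fintype A] [DecidableEq A]
    (hodd : Odd (Fintype.card A))
    (hn : 7 ≤ Fintype.card A) (k : ℕ) (hk1 : k ≠ 1)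
    (hk : k + 3 ≤ Fintype.card A) :
    ∃ C : Finset A, C.card = k ∧ (∀ c ∈ C, c ≠ 0 ∧ c ≠ ∑ c ∈ C, c) := by
  have : Nontrivial A := Fintype.one_lt_card_iff_nontrivial.1 (by omega)
  obtain ⟨x, hx⟩ := exists_ne (0 : A)
  obtain ⟨C, h1, h2, h3⟩ := aux_zero hodd hn x hx k hk1 hk
  refine ⟨C, h1, fun c hc => ?_⟩
  rw [h3]
  exact ⟨(h2 c hc).1, (h2 c hc).1⟩

/-- Transfer from a set to a labeling. -/
lemma aux_transfer {V A : Type} [AddCommGroup A] (D : Finset V) (C : Finset A)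
    (h : C.card = D.card) :
    ∃ g : V → A, Set.InjOn g D ∧ (∀ v ∈ D, g v ∈ C) ∧ ∑ v ∈ D, g v = ∑ c ∈ C, c := by
  classical
  let e := Finset.equivOfCardEq h.symm
  refine ⟨fun v => if hv : v ∈ D then (e ⟨v, hv⟩ : A) else 0, ?_, ?_, ?_⟩
  · intro a ha b hb hab
    have ha' : a ∈ D := ha
    have hb' : b ∈ D := hb
    simp only [ha', hb', dif_pos] at hab
    simpa using e.injective (Subtype.ext hab)
  · intro v hv
    simp only [hv, dif_pos]
    exact (e ⟨v, hv⟩).2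
  · rw [← Finset.sum_coe_sort D, ← Finset.sum_coe_sort C]
    rw [← Equiv.sum_comp e]
    apply Finset.sum_congr rfl
    rintro ⟨v, hv⟩ _
    simp [hv]

lemma aux_parent {V : Type} (T : SimpleGraph V) (hT : T.IsTree) (r v : V) (hv : v ≠ r) :
    ∃ p, T.Adj v p ∧ T.dist r v = T.dist r p + 1 ∧
      ∀ q, T.Adj v q → T.dist r v = T.dist r q + 1 → q = p := by
  obtain ⟨w, hw, hl⟩ := hT.connected.exists_path_of_dist r v
  have hnil : ¬ w.Nil := SimpleGraph.Walk.not_nil_of_ne hv.symm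
  have key : ∀ q, T.Adj v q → T.dist r v = T.dist r q + 1 → q = w.penultimate := by
    intro q hq hd
    obtain ⟨u, hu, hul⟩ := hT.connected.exists_path_of_dist r q
    have hp : (u.concat hq.symm).IsPath := by
      apply SimpleGraph.Walk.isPath_of_length_eq_dist
      rw [SimpleGraph.Walk.length_concat]; omega
    have := (hT.existsUnique_path r v).unique hw hp
    rw [this]; simp
  have hadj := (w.adj_penultimate hnil).symm
  refine ⟨w.penultimate, hadj, ?_, key⟩
  have h1 := T.dist_le w.dropLast
  have h2 : w.dropLast.length + 1 = w.length := SimpleGraph.Walk.length_dropLast_add_one hnil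
  rcases hT.dist_eq_dist_add_one_of_adj r hadj with h | h
  · exact h
  · omega

/-- The recursively chosen state (label of the parent edge, weight of the parent). -/
def auxState {V A : Type} [AddCommGroup A] (par : V → V) (ch : V → Finset V)
    (g : V → A → A → V → A) : ℕ → V → A × A
  | 0, _ => (0, 0)
  | n + 1, u =>
    let q := auxState par ch g n (par u)
    (g (par u) q.1 q.2 u, q.1 + ∑ c ∈ ch (par u), g (par u) q.1 q.2 c)

/-- If `T` is a tree with odd maximum degree `Δ(T) ≥ 5`, then for every Abelian group
`𝒢` of odd order `|𝒢| ≥ Δ(T) + 2` there exists a nowhere-zero `𝒢`-twin edge coloring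
of `T`, except when `T` is a `(|𝒢| - 2)`-regular tree. -/
theorem tree_nowhere_zero_twin_coloring_of_odd {V : Type} [Fintype V] (T : SimpleGraph V)
    [DecidableRel T.Adj] (hT : T.IsTree) (hodddeg : Odd T.maxDegree)
    (hΔ : 5 ≤ T.maxDegree)
    (A : Type) [AddCommGroup A] [Fintype A] (hodd : Odd (Fintype.card A))
    (hcard : T.maxDegree + 2 ≤ Fintype.card A)
    (hexc : ¬ IsRegularTreeDeg T (Fintype.card A - 2)) :
    ∃ f : Sym2 V → A, IsTwinEdgeColoring T f ∧ ∀ e ∈ T.edgeSet, f e ≠ 0 := by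
  classical
  have hn : 7 ≤ Fintype.card A := by omega
  obtain ⟨r, hr1, hr2⟩ : ∃ r, T.degree r ≠ 1 ∧ T.degree r ≠ Fintype.card A - 2 := by
    unfold IsRegularTreeDeg at hexc
    push Not at hexc
    exact hexc
  have hdeg : ∀ v, T.degree v + 2 ≤ Fintype.card A := fun v => by
    have := T.degree_le_maxDegree v
    omega
  have hpar : ∀ v, ∃ p, v ≠ r → (T.Adj v p ∧ T.dist r v = T.dist r p + 1 ∧
      ∀ q, T.Adj v q → T.dist r v = T.dist r q + 1 → q = p) := by
    intro v
    by_cases hv : v = r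
    · exact ⟨r, fun h => absurd hv h⟩
    · obtain ⟨p, hp⟩ := aux_parent T hT r v hv
      exact ⟨p, fun _ => hp⟩
  choose par hpar using hpar
  let d : V → ℕ := fun v => T.dist r v
  have hd : ∀ u v, T.Adj u v → d u = d v + 1 ∨ d v = d u + 1 :=
    fun u v h => hT.dist_eq_dist_add_one_of_adj r h
  have hdr : d r = 0 := SimpleGraph.dist_self
  let ch : V → Finset V := fun v => (T.neighborFinset v).filter (fun u => d u = d v + 1)
  have hch : ∀ v u, u ∈ ch v ↔ T.Adj v u ∧ d u = d v + 1 := by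
    intro v u; simp [ch]
  have hchpar : ∀ v u, u ∈ ch v → u ≠ r ∧ par u = v := by
    intro v u hu
    obtain ⟨h1, h2⟩ := (hch v u).1 hu
    have hur : u ≠ r := by rintro rfl; omega
    exact ⟨hur, ((hpar u hur).2.2 v h1.symm h2).symm⟩
  have hparch : ∀ v, par v ∉ ch v ∨ v = r := by
    intro v
    by_cases hv : v = r
    · exact Or.inr hv
    · left; intro h
      have h1 := ((hch _ _).1 h).2
      have h2 : d v = d (par v) + 1 := (hpar v hv).2.1
      omega
  have hnr : T.neighborFinset r = ch r := by
    ext u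
    rw [hch, SimpleGraph.mem_neighborFinset]
    refine ⟨fun h => ⟨h, ?_⟩, fun h => h.1⟩
    rcases hd _ _ h with h | h <;> omega
  have hnv : ∀ v, v ≠ r → T.neighborFinset v = insert (par v) (ch v) := by
    intro v hv
    ext u
    rw [Finset.mem_insert, hch, SimpleGraph.mem_neighborFinset]
    constructor
    · intro h
      rcases hd _ _ h with h' | h'
      · exact Or.inl ((hpar v hv).2.2 u h h')
      · exact Or.inr ⟨h, h'⟩
    · rintro (rfl | h)
      · exact (hpar v hv).1
      · exact h.1
  have hcr : (ch r).card = T.degree r := by rw [← hnr]; simp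
  have hcv : ∀ v, v ≠ r → (ch v).card + 1 = T.degree v := by
    intro v hv
    rw [← SimpleGraph.card_neighborFinset_eq_degree, hnv v hv,
      Finset.card_insert_of_notMem ((hparch v).resolve_right hv)]
  -- local choices
  have hloc : ∀ (v : V) (x s : A), ∃ g : V → A,
      ((v = r ∧ x = 0) ∨ (v ≠ r ∧ x ≠ 0 ∧ x ≠ s)) →
      Set.InjOn g (ch v) ∧ (∀ u ∈ ch v, g u ≠ 0 ∧ g u ≠ x ∧ g u ≠ x + ∑ c ∈ ch v, g c) ∧
      (v ≠ r → x + ∑ c ∈ ch v, g c ≠ s) := by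
    intro v x s
    by_cases hgood : ((v = r ∧ x = 0) ∨ (v ≠ r ∧ x ≠ 0 ∧ x ≠ s))
    swap
    · exact ⟨fun _ => 0, fun h => absurd h hgood⟩
    rcases hgood with ⟨rfl, rfl⟩ | ⟨hv, hx, hxs⟩
    · have := hdeg v
      obtain ⟨C, hC, h1⟩ := aux_root hodd hn (T.degree v) hr1 (by omega)
      obtain ⟨g, g1, g2, g3⟩ := aux_transfer (ch v) C (by rw [hC, hcr])
      refine ⟨g, fun _ => ⟨g1, ?_, fun h => absurd rfl h⟩⟩
      intro u hu
      rw [g3, zero_add]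
      exact ⟨(h1 _ (g2 u hu)).1, (h1 _ (g2 u hu)).1, (h1 _ (g2 u hu)).2⟩
    · have := hdeg v
      have := hcv v hv
      obtain ⟨C, hC, h1, h2⟩ := aux_nonroot hodd hn x s hx hxs (ch v).card (by omega)
      obtain ⟨g, g1, g2, g3⟩ := aux_transfer (ch v) C hC
      refine ⟨g, fun _ => ⟨g1, ?_, ?_⟩⟩
      · intro u hu
        rw [g3]
        exact h1 _ (g2 u hu)
      · intro _
        rw [g3]
        exact h2
  choose g hg using hloc
  let S : V → A × A := fun v => auxState par ch g (d v) v
  let W : V → A := fun v => (S v).1 + ∑ c ∈ ch v, g v (S v).1 (S v).2 c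
  have hS : ∀ v u, u ∈ ch v → S u = (g v (S v).1 (S v).2 u, W v) := by
    intro v u hu
    obtain ⟨h1, h2⟩ := hchpar v u hu
    have h3 := ((hch v u).1 hu).2
    simp only [S, W, h3, auxState, h2]
  have hSr : (S r).1 = 0 := by simp only [S, hdr, auxState]
  have hgood : ∀ n v, d v = n →
      ((v = r ∧ (S v).1 = 0) ∨ (v ≠ r ∧ (S v).1 ≠ 0 ∧ (S v).1 ≠ (S v).2)) := by
    intro n
    induction n with
    | zero =>
      intro v hv
      left
      have : r = v := hT.connected.dist_eq_zero_iff.1 hv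
      exact ⟨this.symm, this ▸ hSr⟩
    | succ n ih =>
      intro v hv
      have hvr : v ≠ r := by rintro rfl; omega
      right
      have hp := hpar v hvr
      have hp2 : d v = d (par v) + 1 := hp.2.1
      have hmem : v ∈ ch (par v) := (hch _ _).2 ⟨hp.1.symm, hp2⟩
      have := hg (par v) (S (par v)).1 (S (par v)).2 (ih (par v) (by omega))
      have h3 := this.2.1 v hmem
      rw [hS _ _ hmem]
      exact ⟨hvr, h3.1, h3.2.2⟩
  have hG := fun v => hg v (S v).1 (S v).2 (hgood _ v rfl)
  let f : Sym2 V → A := Sym2.lift ⟨fun u v => if d u < d v then (S v).1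
      else if d v < d u then (S u).1 else 0, by
    intro u v
    rcases lt_trichotomy (d u) (d v) with h | h | h
    · simp [h, h.not_gt]
    · simp [h]
    · simp [h, h.not_gt]⟩
  have hf1 : ∀ v u, u ∈ ch v → f s(v, u) = g v (S v).1 (S v).2 u := by
    intro v u hu
    have h3 := ((hch v u).1 hu).2
    have h4 : d v < d u := by omega
    simp only [f, Sym2.lift_mk, h4, if_true]
    rw [hS v u hu]
  have hf2 : ∀ v, v ≠ r → f s(v, par v) = (S v).1 := by
    intro v hv
    have hp2 : d v = d (par v) + 1 := (hpar v hv).2.1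
    have h4 : d (par v) < d v := by omega
    simp only [f, Sym2.lift_mk, h4, h4.not_gt, if_true, if_false]
  have hmemN : ∀ u v, T.Adj u v → v ∈ ch u ∨ (u ≠ r ∧ v = par u) := by
    intro u v h
    by_cases hu : u = r
    · left; subst hu; rw [← hnr]; simpa using h
    · have : v ∈ T.neighborFinset u := by simpa using h
      rw [hnv u hu, Finset.mem_insert] at this
      tauto
  have hw : ∀ v, ∑ x ∈ T.neighborFinset v, f s(x, v) = W v := by
    intro v
    have hsum : ∑ x ∈ ch v, f s(x, v) = ∑ c ∈ ch v, g v (S v).1 (S v).2 c := by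
      apply Finset.sum_congr rfl
      intro u hu
      rw [Sym2.eq_swap, hf1 v u hu]
    by_cases hv : v = r
    · subst hv
      rw [hnr, hsum]
      simp only [W, hSr, zero_add]
    · rw [hnv v hv, Finset.sum_insert ((hparch v).resolve_right hv), hsum, Sym2.eq_swap, hf2 v hv]
  have hWch : ∀ v u, u ∈ ch v → W u ≠ W v := by
    intro v u hu
    have h := (hG u).2.2 (hchpar v u hu).1
    have h2 : (S u).2 = W v := by rw [hS v u hu]
    rw [← h2]
    exact h
  refine ⟨f, ⟨?_, ?_⟩, ?_⟩
  · intro u v w huv huw hvw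
    rcases hmemN u v huv with hv | ⟨hu, hv⟩ <;> rcases hmemN u w huw with hw' | ⟨hu', hw'⟩
    · rw [hf1 u v hv, hf1 u w hw']
      exact fun h => hvw ((hG u).1 hv hw' h)
    · rw [hf1 u v hv, hw', hf2 u hu']
      exact ((hG u).2.1 v hv).2.1
    · rw [hf1 u w hw', hv, hf2 u hu]
      exact ((hG u).2.1 w hw').2.1.symm
    · exact absurd (hv.trans hw'.symm) hvw
  · intro u v huv
    rw [hw, hw]
    rcases hd u v huv with h | h
    · exact hWch v u ((hch _ _).2 ⟨huv.symm, h⟩)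
    · exact (hWch u v ((hch _ _).2 ⟨huv, h⟩)).symm
  · intro e
    induction e using Sym2.ind with
    | _ u v =>
      intro he
      have huv : T.Adj u v := he
      rcases hd u v huv with h | h
      · have hm := (hch _ _).2 ⟨huv.symm, h⟩
        rw [Sym2.eq_swap, hf1 v u hm]
        exact ((hG v).2.1 u hm).1
      · have hm := (hch _ _).2 ⟨huv, h⟩
        rw [hf1 u v hm]
        exact ((hG u).2.1 v hm).1
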